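/- arXiv:1501.03602 — 2 statements merged into one kernel-verified Lean document; each statement's English description precedes it below -/
import Mathlib

section
/- Let A be an alphabet and let x, y, u, v be words over A with x ≠ u. Suppose that x^i y^j x^k = u^i v^j u^k, where i, k are positive integers with i + k ≥ 3 and j ≥ 3. Then the words x, y, u, v pairwise commute (equivalently, all four are powers of a single common word). -/
namespace FreeMonoid

variable {A : Type*}

theorem length_pow (a : FreeMonoid A) (n : ℕ) : (a ^ n).length = n * a.length := by
  induction n with
  | zero => simp
  | succ n ih => rw [pow_succ, length_mul, ih]; ring

theorem length_pos_of_ne_one {a : FreeMonoid A} (h : a ≠ 1) : 0 < a.length :=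
  Nat.pos_of_ne_zero fun h0 => h (length_eq_zero.1 h0)

/-- Levi's lemma. -/
theorem exists_eq_mul_of_mul_eq_mul {a b c d : FreeMonoid A} (h : a * b = c * d)
    (hl : a.length ≤ c.length) : ∃ e, c = a * e ∧ b = e * d := by
  rcases List.append_eq_append_iff.1 (show a.toList ++ b.toList = c.toList ++ d.toList from h) with
    ⟨e, h1, h2⟩ | ⟨e, h1, h2⟩
  · exact ⟨ofList e, h1, h2⟩
  · have he : e = [] := by
      have := congrArg List.length h1
      rw [List.length_append] at this
      have h3 : a.toList.length ≤ c.toList.length := hl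
      exact List.length_eq_zero_iff.1 (by omega)
    subst he
    refine ⟨1, ?_, ?_⟩
    · rw [mul_one]; exact (h1.trans (List.append_nil _)).symm
    · rw [one_mul]; exact h2.symm

theorem eq_and_eq_of_mul_eq_mul {a b c d : FreeMonoid A} (h : a * b = c * d)
    (hl : a.length = c.length) : a = c ∧ b = d := by
  obtain ⟨e, rfl, rfl⟩ := exists_eq_mul_of_mul_eq_mul h hl.le
  have : e = 1 := by
    rw [length_mul] at hl
    exact length_eq_zero.1 (by omega)
  subst this
  simp

theorem exists_eq_mul_of_mul_eq_mul' {a b c d : FreeMonoid A} (h : a * b = c * d)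
    (hl : b.length ≤ d.length) : ∃ e, d = e * b ∧ a = c * e := by
  have := congrArg length h
  simp only [length_mul] at this
  obtain ⟨e, h1, h2⟩ := exists_eq_mul_of_mul_eq_mul h.symm (by omega)
  exact ⟨e, h2, h1⟩

theorem eq_and_eq_of_mul_eq_mul' {a b c d : FreeMonoid A} (h : a * b = c * d)
    (hl : b.length = d.length) : a = c ∧ b = d := by
  have := congrArg length h
  simp only [length_mul] at this
  exact eq_and_eq_of_mul_eq_mul h (by omega)

theorem dvd_of_dvd_of_length_le {a b w : FreeMonoid A} (ha : a ∣ w) (hb : b ∣ w)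
    (hl : a.length ≤ b.length) : a ∣ b := by
  obtain ⟨c, rfl⟩ := ha
  obtain ⟨d, hd⟩ := hb
  obtain ⟨e, h, -⟩ := exists_eq_mul_of_mul_eq_mul hd hl
  exact ⟨e, h⟩

theorem eq_of_dvd_of_length_eq {a b w : FreeMonoid A} (ha : a ∣ w) (hb : b ∣ w)
    (hl : a.length = b.length) : a = b := by
  obtain ⟨c, rfl⟩ := ha
  obtain ⟨d, hd⟩ := hb
  exact (eq_and_eq_of_mul_eq_mul hd hl).1

theorem length_le_of_dvd {a b : FreeMonoid A} (h : a ∣ b) : a.length ≤ b.length := by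
  obtain ⟨c, rfl⟩ := h
  rw [length_mul]; omega

/-- The suffix order on words; the prefix order is divisibility. -/
def IsSuffix (a w : FreeMonoid A) : Prop := ∃ c, w = c * a

theorem isSuffix_mul (a b : FreeMonoid A) : IsSuffix b (a * b) := ⟨a, rfl⟩

theorem IsSuffix.trans {a b c : FreeMonoid A} (h : IsSuffix a b) (h' : IsSuffix b c) :
    IsSuffix a c := by
  obtain ⟨d, rfl⟩ := h
  obtain ⟨e, rfl⟩ := h'
  exact ⟨e * d, (mul_assoc _ _ _).symm⟩

theorem isSuffix_iff {a w : FreeMonoid A} : IsSuffix a w ↔ reverse a ∣ reverse w := by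
  constructor
  · rintro ⟨c, rfl⟩
    exact ⟨reverse c, reverse_mul⟩
  · rintro ⟨c, hc⟩
    refine ⟨reverse c, ?_⟩
    have := congrArg reverse hc
    rwa [reverse_reverse, reverse_mul, reverse_reverse] at this

theorem IsSuffix.of_length_le {a b w : FreeMonoid A} (ha : IsSuffix a w) (hb : IsSuffix b w)
    (hl : a.length ≤ b.length) : IsSuffix a b := by
  rw [isSuffix_iff] at *
  exact dvd_of_dvd_of_length_le ha hb (by simpa using hl)

theorem IsSuffix.eq_of_length_eq {a b w : FreeMonoid A} (ha : IsSuffix a w) (hb : IsSuffix b w)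
    (hl : a.length = b.length) : a = b := by
  obtain ⟨c, rfl⟩ := ha
  obtain ⟨d, hd⟩ := hb
  exact (eq_and_eq_of_mul_eq_mul' hd hl).2

/-- A weak form of the Fine–Wilf periodicity theorem. -/
theorem commute_of_dvd {a b w : FreeMonoid A} (ha : w ∣ a * w) (hb : w ∣ b * w)
    (hl : a.length + b.length ≤ w.length) : Commute a b := by
  have ha' : a ∣ w := dvd_of_dvd_of_length_le (dvd_mul_right a w) ha (by omega)
  have hb' : b ∣ w := dvd_of_dvd_of_length_le (dvd_mul_right b w) hb (by omega)
  have hab : a * b ∣ w := dvd_of_dvd_of_length_le (mul_dvd_mul_left a hb') ha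
    (by rw [length_mul]; omega)
  have hba : b * a ∣ w := dvd_of_dvd_of_length_le (mul_dvd_mul_left b ha') hb
    (by rw [length_mul]; omega)
  exact eq_of_dvd_of_length_eq hab hba (by simp only [length_mul]; omega)

theorem reverse_injective : Function.Injective (reverse : FreeMonoid A → FreeMonoid A) :=
  fun a b h => by rw [← reverse_reverse (a := a), h, reverse_reverse]

theorem reverse_pow (a : FreeMonoid A) (n : ℕ) : reverse (a ^ n) = reverse a ^ n := by
  induction n with
  | zero => rfl
  | succ n ih => rw [pow_succ, reverse_mul, ih, pow_succ']

theorem commute_reverse {a b : FreeMonoid A} :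
    Commute (reverse a) (reverse b) ↔ Commute a b := by
  constructor
  · intro h
    apply reverse_injective
    rw [reverse_mul, reverse_mul]
    exact h.symm
  · intro h
    have := congrArg reverse h.eq
    rw [reverse_mul, reverse_mul] at this
    exact this.symm

theorem commute_of_isSuffix {a b w : FreeMonoid A} (ha : IsSuffix w (w * a))
    (hb : IsSuffix w (w * b)) (hl : a.length + b.length ≤ w.length) : Commute a b := by
  rw [isSuffix_iff, reverse_mul] at ha hb
  exact commute_reverse.1 (commute_of_dvd ha hb (by simpa using hl))

theorem dvd_mul_of_commute {a w : FreeMonoid A} (h : Commute a w) : w ∣ a * w :=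
  ⟨a, h.eq⟩

theorem commute_of_commute_of_ne_one {x y z : FreeMonoid A} (hxy : Commute x y) (hy : y ≠ 1)
    (hyz : Commute y z) : Commute x z := by
  refine commute_of_dvd (w := y ^ (x.length + z.length))
    (dvd_mul_of_commute (hxy.pow_right _)) (dvd_mul_of_commute (hyz.symm.pow_right _)) ?_
  rw [length_pow]
  exact Nat.le_mul_of_pos_right _ (length_pos_of_ne_one hy)

theorem pow_ne_one {z : FreeMonoid A} (hz : z ≠ 1) {n : ℕ} (hn : n ≠ 0) : z ^ n ≠ 1 := by
  intro h
  have h1 := congrArg length h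
  rw [length_pow, length_one] at h1
  have := length_pos_of_ne_one hz
  rcases Nat.mul_eq_zero.1 h1 with h | h <;> omega

theorem commute_of_commute_pow {x z : FreeMonoid A} {n : ℕ} (hn : n ≠ 0)
    (h : Commute x (z ^ n)) : Commute x z := by
  by_cases hz : z = 1
  · subst hz; exact Commute.one_right x
  · exact commute_of_commute_of_ne_one h (pow_ne_one hz hn) (Commute.pow_self z n)

theorem eq_of_pow_eq {x z : FreeMonoid A} {n : ℕ} (hn : n ≠ 0) (h : x ^ n = z ^ n) : x = z := by
  obtain ⟨m, rfl⟩ := Nat.exists_eq_succ_of_ne_zero hn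
  rw [pow_succ', pow_succ'] at h
  refine (eq_and_eq_of_mul_eq_mul h ?_).1
  have := congrArg length h
  simp only [length_mul, length_pow] at this
  nlinarith

theorem exists_pow_of_commute {x y : FreeMonoid A} (h : Commute x y) :
    ∃ (t : FreeMonoid A) (k l : ℕ), x = t ^ k ∧ y = t ^ l := by
  induction hn : x.length + y.length using Nat.strong_induction_on generalizing x y with
  | _ n ih =>
    wlog hl : x.length ≤ y.length generalizing x y with H
    · obtain ⟨t, k, l, h1, h2⟩ := H h.symm (by omega) (by omega)
      exact ⟨t, l, k, h2, h1⟩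
    by_cases hx : x = 1
    · exact ⟨y, 0, 1, by simp [hx], by simp⟩
    obtain ⟨e, h1, h2⟩ := exists_eq_mul_of_mul_eq_mul h.eq hl
    have hxe : Commute x e := h1.symm.trans h2
    have := length_pos_of_ne_one hx
    obtain ⟨t, k, l, h3, h4⟩ := ih (x.length + e.length)
      (by rw [h1, length_mul] at hn; omega) hxe rfl
    exact ⟨t, k, k + l, h3, by rw [h1, pow_add, ← h3, ← h4]⟩

/-- If `z` commutes with `a * b`, then `z` has a conjugate by `b`, which `a` conjugates back to `z`. -/
theorem exists_semiconjBy {a b z : FreeMonoid A} (h : Commute (a * b) z) :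
    ∃ z', SemiconjBy b z z' ∧ SemiconjBy a z' z ∧ z'.length = z.length := by
  obtain ⟨e, h1, h2⟩ := exists_eq_mul_of_mul_eq_mul'
    (show (z * a) * b = a * (b * z) by rw [← mul_assoc a, h.eq, mul_assoc]) (by simp)
  refine ⟨e, h1, h2.symm, ?_⟩
  have := congrArg length h1
  simp only [length_mul] at this
  omega

theorem exists_conj_pow {a b z : FreeMonoid A} {n : ℕ} (h : a * b = z ^ n) :
    ∃ z', b * a = z' ^ n ∧ SemiconjBy b z z' ∧ SemiconjBy a z' z ∧ z'.length = z.length := by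
  obtain ⟨z', h1, h2, h3⟩ := exists_semiconjBy (h ▸ Commute.pow_self z n : Commute (a * b) z)
  refine ⟨z', ?_, h1, h2, h3⟩
  have := (h1.pow_right n).eq
  rw [← h, ← mul_assoc] at this
  exact mul_right_cancel this

theorem exists_of_semiconjBy_pow {a z w : FreeMonoid A} {n : ℕ} (hn : n ≠ 0)
    (h : SemiconjBy z (a ^ n) w) : ∃ c, SemiconjBy z a c ∧ c ^ n = w := by
  by_cases ha : a = 1
  · subst ha
    refine ⟨1, SemiconjBy.one_right z, ?_⟩
    have := h.eq
    rw [one_pow, mul_one] at this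
    rw [one_pow]
    exact mul_right_cancel ((one_mul z).trans this)
  have h1 := (h.pow_right z.length).eq
  rw [← pow_mul] at h1
  obtain ⟨y, hy, -⟩ := exists_eq_mul_of_mul_eq_mul' h1.symm (by
    rw [length_pow]
    have := length_pos_of_ne_one ha
    have := Nat.pos_of_ne_zero hn
    calc z.length = 1 * z.length * 1 := by ring
      _ ≤ _ := by gcongr <;> omega)
  obtain ⟨c, hc, -⟩ := exists_eq_mul_of_mul_eq_mul'
    (show (z * a * y) * z = w ^ z.length * (z * a) by
      rw [mul_assoc _ y, ← hy, mul_assoc, ← pow_succ', pow_succ, ← mul_assoc, h1, mul_assoc])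
      (by simp)
  refine ⟨c, hc, ?_⟩
  have h2 : SemiconjBy z a c := hc
  have h3 := (h2.pow_right n).eq
  rw [h.eq] at h3
  exact (mul_right_cancel h3).symm

theorem dvd_mul_self_of_dvd_pow {w z : FreeMonoid A} {n : ℕ} (h : w ∣ z ^ n) : w ∣ z * w := by
  have h1 : z * w ∣ z ^ (n + 1) := by rw [pow_succ']; exact mul_dvd_mul_left z h
  exact dvd_of_dvd_of_length_le (h.trans (pow_dvd_pow z n.le_succ)) h1 (by simp)

theorem IsSuffix.self_mul_of_pow {w z : FreeMonoid A} {n : ℕ} (h : IsSuffix w (z ^ n)) :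
    IsSuffix w (w * z) := by
  rw [isSuffix_iff, reverse_pow] at h
  rw [isSuffix_iff, reverse_mul]
  exact dvd_mul_self_of_dvd_pow h

theorem append_lt_append_of_lt [LinearOrder A] {a b : List A} (m n : List A) (h : a < b)
    (hl : a.length = b.length) : a ++ m < b ++ n := by
  have h' : List.Lex (· < ·) a b := h
  change List.Lex (· < ·) (a ++ m) (b ++ n)
  clear h
  induction h' with
  | nil => simp at hl
  | rel h => exact List.Lex.rel h
  | cons _ ih => exact List.Lex.cons (ih (by simpa using hl))

theorem exists_min_conj [LinearOrder A] (z : FreeMonoid A) :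
    ∃ z₁ z₂, z = z₁ * z₂ ∧
      ∀ c d, z₂ * z₁ = c * d → (z₂ * z₁).toList ≤ (d * c).toList := by
  obtain ⟨n, -, hn⟩ := Finset.exists_min_image (Finset.range (z.length + 1))
    (fun n => (z.toList.drop n ++ z.toList.take n : List A)) ⟨0, by simp⟩
  have hmin : ∀ c d : FreeMonoid A, z = c * d →
      (z.toList.drop n ++ z.toList.take n : List A) ≤ d.toList ++ c.toList := by
    intro c d h
    have h1 := hn c.toList.length (by
      rw [Finset.mem_range, h, length_mul]
      exact Nat.lt_succ_of_le (Nat.le_add_right _ _))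
    have h2 : z.toList = c.toList ++ d.toList := h
    rw [h2, List.drop_left, List.take_left] at h1
    rwa [h2]
  obtain ⟨z₁, h₁⟩ : ∃ z₁, z₁ = ofList (z.toList.take n) := ⟨_, rfl⟩
  obtain ⟨z₂, h₂⟩ : ∃ z₂, z₂ = ofList (z.toList.drop n) := ⟨_, rfl⟩
  have key : z = z₁ * z₂ := by
    rw [h₁, h₂]
    exact (List.take_append_drop n z.toList).symm
  refine ⟨z₁, z₂, key, fun c d h => ?_⟩
  have h3 : ∀ e f : FreeMonoid A, z = e * f → (z₂ * z₁).toList ≤ (f * e).toList := by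
    rw [h₁, h₂]
    exact hmin
  rcases le_total z₂.length c.length with hl | hl
  · obtain ⟨e, rfl, rfl⟩ := exists_eq_mul_of_mul_eq_mul h hl
    simpa only [mul_assoc] using h3 e (d * z₂) (by rw [key, mul_assoc])
  · obtain ⟨e, rfl, rfl⟩ := exists_eq_mul_of_mul_eq_mul h.symm hl
    simpa only [mul_assoc] using h3 (z₁ * c) e (by rw [key, mul_assoc])

/-- Every primitive word has an unbordered conjugate. -/
theorem exists_unbordered_conj {z : FreeMonoid A} (hz : ∀ t n, z = t ^ n → n < 2) :
    ∃ z₁ z₂, z = z₁ * z₂ ∧ ∀ a b m, z₂ * z₁ = m * a → z₂ * z₁ = b * m → a = 1 ∨ m = 1 := by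
  classical
  let _ : LinearOrder A := linearOrderOfSTO (WellOrderingRel (α := A))
  obtain ⟨z₁, z₂, key, hmin⟩ := exists_min_conj z
  refine ⟨z₁, z₂, key, fun a b m h1 h2 => ?_⟩
  have h3 := hmin _ _ h1
  have h4 := hmin _ _ h2
  rw [h2] at h3
  rw [h1] at h4
  have hl : a.length = b.length := by
    have := congrArg length (h1.symm.trans h2)
    simp only [length_mul] at this
    omega
  have hab : a.toList = b.toList := by
    refine le_antisymm ?_ ?_
    · by_contra h
      exact absurd h4 (not_le.2 (List.append_left_lt (not_le.1 h)))
    · by_contra h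
      exact absurd h3 (not_le.2 (append_lt_append_of_lt m m (not_le.1 h) hl))
  obtain rfl : a = b := hab
  obtain ⟨t, k, l, rfl, rfl⟩ := exists_pow_of_commute (h1.symm.trans h2 : Commute m a)
  rw [← pow_add] at h1
  obtain ⟨t', ht', -⟩ := exists_conj_pow h1
  have := hz t' (k + l) (key.trans ht')
  rcases Nat.eq_zero_or_pos k with rfl | hk
  · exact Or.inr (pow_zero t)
  · obtain rfl : l = 0 := by omega
    exact Or.inl (pow_zero t)

theorem exists_border_of_mul_eq_pow {x g l e : FreeMonoid A} {n : ℕ} (h : x ^ n = g * l * e)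
    (hl : x.length < l.length) (hx : x ≠ 1) :
    ∃ a b m, l = m * a ∧ l = b * m ∧ a ≠ 1 ∧ m ≠ 1 := by
  rw [mul_assoc] at h
  obtain ⟨x', h1, -, -, h4⟩ := exists_conj_pow h.symm
  have h5 : l ∣ x' ^ n := by rw [← h1, mul_assoc]; exact dvd_mul_right _ _
  have h6 : x' ∣ l := dvd_of_dvd_of_length_le (dvd_mul_right _ _) (dvd_mul_self_of_dvd_pow h5)
    (by omega)
  obtain ⟨m, hm⟩ := h6
  obtain ⟨c, hc⟩ := dvd_mul_self_of_dvd_pow h5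
  obtain ⟨a, ha⟩ : m ∣ l := ⟨c, by
    refine mul_left_cancel (a := x') ?_
    rw [hc, hm, mul_assoc]⟩
  refine ⟨a, x', m, ha, hm, ?_, ?_⟩
  · rintro rfl
    rw [mul_one] at ha
    rw [ha] at hm
    exact hx (length_eq_zero.1 (by
      have := congrArg length hm
      rw [length_mul] at this
      omega))
  · rintro rfl
    rw [mul_one] at hm
    rw [hm] at hl
    omega

theorem commute_of_mul_pow_eq_pow_of_commute_left {x y z : FreeMonoid A} {a b c : ℕ}
    (h : x ^ a * y ^ b = z ^ c) (hb : b ≠ 0) (hz : Commute x z) : Commute x y := by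
  refine commute_of_commute_pow hb ?_
  have h1 : Commute x (x ^ a * y ^ b) := h ▸ hz.pow_right c
  have h2 := h1.eq
  rw [← mul_assoc, (Commute.self_pow x a).eq, mul_assoc, mul_assoc] at h2
  exact mul_left_cancel h2

theorem commute_of_mul_pow_eq_pow_of_commute_right {x y z : FreeMonoid A} {a b c : ℕ}
    (h : x ^ a * y ^ b = z ^ c) (ha : a ≠ 0) (hz : Commute y z) : Commute x y := by
  refine (commute_of_commute_pow ha ?_).symm
  have h1 : Commute y (x ^ a * y ^ b) := h ▸ hz.pow_right c
  have h2 := h1.eq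
  rw [mul_assoc, ← (Commute.self_pow y b).eq, ← mul_assoc, ← mul_assoc] at h2
  exact mul_right_cancel h2

/-- The **Lyndon–Schützenberger theorem**. -/
theorem commute_of_pow_mul_pow_eq_pow {x y z : FreeMonoid A} {a b c : ℕ} (ha : 2 ≤ a)
    (hb : 2 ≤ b) (hc : 2 ≤ c) (h : x ^ a * y ^ b = z ^ c) : Commute x y := by
  induction hn : z.length using Nat.strong_induction_on generalizing x y z a b c with
  | _ n ih =>
    by_cases hx : x = 1
    · rw [hx]; exact Commute.one_left y
    by_cases hy : y = 1
    · rw [hy]; exact Commute.one_right x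
    have hlx := length_pos_of_ne_one hx
    by_cases hxz : x.length + z.length ≤ (x ^ a).length
    · exact commute_of_mul_pow_eq_pow_of_commute_left h (by omega)
        (commute_of_dvd (dvd_mul_of_commute (Commute.self_pow x a))
          (dvd_mul_self_of_dvd_pow ⟨_, h.symm⟩) hxz)
    by_cases hyz : y.length + z.length ≤ (y ^ b).length
    · exact commute_of_mul_pow_eq_pow_of_commute_right h (by omega)
        (commute_of_isSuffix ⟨y, (Commute.self_pow y b).symm⟩
          (IsSuffix.self_mul_of_pow ⟨_, h.symm⟩) hyz)
    have hxz' : x.length < z.length := by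
      rw [length_pow] at hxz
      nlinarith
    have hyz' : y.length < z.length := by
      rw [length_pow] at hyz
      nlinarith
    by_cases hz : ∀ t n, z = t ^ n → n < 2
    swap
    · push Not at hz
      obtain ⟨t, e, ht, he⟩ := hz
      have ht1 : t ≠ 1 := by
        rintro rfl
        rw [ht, one_pow, length_one] at hxz'
        omega
      have := length_pos_of_ne_one ht1
      refine ih t.length ?_ ha hb (by nlinarith : 2 ≤ e * c) (h.trans (by rw [ht, pow_mul])) rfl
      rw [← hn, ht, length_pow]
      nlinarith
    rcases hc.eq_or_lt with rfl | hc
    · rw [pow_two] at h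
      rcases le_total z.length (x ^ a).length with hl | hl
      · obtain ⟨t, h1, h2⟩ := exists_eq_mul_of_mul_eq_mul h.symm hl
        have h3 : t * (y ^ b * t) = x ^ a := by rw [← mul_assoc, ← h2, h1]
        obtain ⟨x', h4, -, -, h5⟩ := exists_conj_pow h3
        have h6 : Commute y t := ih x'.length (by omega) hb le_rfl ha
          (by rw [← h4, pow_two, mul_assoc]) rfl
        refine commute_of_mul_pow_eq_pow_of_commute_right (h.trans (pow_two z).symm)
          (by omega) ?_
        rw [h2]
        exact h6.mul_right (Commute.self_pow y b)
      · obtain ⟨t, h1, h2⟩ := exists_eq_mul_of_mul_eq_mul h hl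
        have h3 : t * x ^ a * t = y ^ b := by rw [mul_assoc, ← h1, h2]
        obtain ⟨y', h4, -, -, h5⟩ := exists_conj_pow h3
        have h6 : Commute t x := ih y'.length (by omega) le_rfl ha hb
          (by rw [← h4, pow_two, mul_assoc]) rfl
        refine commute_of_mul_pow_eq_pow_of_commute_left (h.trans (pow_two z).symm)
          (by omega) ?_
        rw [h1]
        exact (Commute.self_pow x a).mul_right h6.symm
    · exfalso
      obtain ⟨z₁, z₂, rfl, hub⟩ := exists_unbordered_conj hz
      obtain ⟨d, rfl⟩ : ∃ d, c = d + 3 := ⟨c - 3, by omega⟩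
      have h1 : (z₁ * (z₂ * z₁)) * ((z₂ * z₁) * ((z₂ * z₁) ^ d * z₂)) = x ^ a * y ^ b := by
        have h2 : SemiconjBy z₂ ((z₁ * z₂) ^ d) ((z₂ * z₁) ^ d) :=
          SemiconjBy.pow_right (mul_assoc _ _ _).symm d
        rw [h, ← h2.eq, add_comm d, pow_add]
        simp only [pow_succ, pow_zero, one_mul, mul_assoc]
      rcases le_total (z₁ * (z₂ * z₁)).length (x ^ a).length with hl | hl
      · obtain ⟨e, h2, -⟩ := exists_eq_mul_of_mul_eq_mul h1 hl
        obtain ⟨a, b, m, h3, h4, h5, h6⟩ := exists_border_of_mul_eq_pow h2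
          (by simp only [length_mul] at *; omega) hx
        exact (hub a b m h3 h4).elim h5 h6
      · obtain ⟨e, -, h2⟩ := exists_eq_mul_of_mul_eq_mul h1.symm hl
        rw [← mul_assoc] at h2
        obtain ⟨a, b, m, h3, h4, h5, h6⟩ := exists_border_of_mul_eq_pow h2
          (by simp only [length_mul] at *; omega) hy
        exact (hub a b m h3 h4).elim h5 h6

/-- The four words commute pairwise. -/
def PairwiseCommute (x y u v : FreeMonoid A) : Prop :=
  Commute x y ∧ Commute x u ∧ Commute x v ∧ Commute y u ∧ Commute y v ∧ Commute u v

/-- The data attached to a solution of `x ^ i * y ^ j * x ^ k = u ^ i * v ^ j * u ^ k` with `u`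
shorter than `x`: the parts `p` and `q` of the outer powers of `x` which protrude into the
power of `v`, together with suitable conjugates `w` of `v` and `z` of `x`. -/
structure IsSolution (x y u v p q w z : FreeMonoid A) (i j k : ℕ) : Prop where
  one_le_left : 1 ≤ i
  one_le_right : 1 ≤ k
  three_le_add : 3 ≤ i + k
  three_le : 3 ≤ j
  lt : u.length < x.length
  left : x ^ i = u ^ i * p
  right : x ^ k = q * u ^ k
  mid : v ^ j = p * y ^ j * q
  semiconj_mid : SemiconjBy q v w
  conj_mid : w ^ j = q * p * y ^ j
  semiconj_outer : SemiconjBy (u ^ (i + k) * p) x z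
  conj_outer : z ^ (i + k) = u ^ (i + k) * p * q

theorem exists_isSolution {x y u v : FreeMonoid A} {i j k : ℕ} (hi : 1 ≤ i) (hk : 1 ≤ k)
    (hik : 3 ≤ i + k) (hj : 3 ≤ j) (hlt : u.length < x.length)
    (h : x ^ i * y ^ j * x ^ k = u ^ i * v ^ j * u ^ k) :
    ∃ p q w z, IsSolution x y u v p q w z i j k := by
  obtain ⟨p, hp, h1⟩ := exists_eq_mul_of_mul_eq_mul
    (show u ^ i * (v ^ j * u ^ k) = x ^ i * (y ^ j * x ^ k) by simp only [← mul_assoc, h])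
    (by simp only [length_pow]; gcongr)
  obtain ⟨q, hq, h2⟩ := exists_eq_mul_of_mul_eq_mul'
    (show v ^ j * u ^ k = (p * y ^ j) * x ^ k by rw [h1, mul_assoc])
    (by simp only [length_pow]; gcongr)
  obtain ⟨w, hw, hw', -⟩ := exists_conj_pow h2.symm
  have h3 : q * (u ^ (i + k) * p) = x ^ (i + k) := by
    rw [add_comm i k, pow_add, pow_add, hp, hq]
    simp only [mul_assoc]
  obtain ⟨z, hz, hz', -⟩ := exists_conj_pow h3
  exact ⟨p, q, w, z, hi, hk, hik, hj, hlt, hp, hq, h2, hw', by rw [← hw, mul_assoc], hz', hz.symm⟩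

theorem length_eq_of_semiconjBy {a b c : FreeMonoid A} (h : SemiconjBy a b c) :
    b.length = c.length := by
  have := congrArg length h.eq
  simp only [length_mul] at this
  omega

namespace IsSolution

variable {x y u v p q w z : FreeMonoid A} {i j k : ℕ}

theorem length_left (h : IsSolution x y u v p q w z i j k) :
    p.length = i * (x.length - u.length) := by
  have h1 := congrArg length h.left
  have h2 := h.lt
  simp only [length_mul, length_pow] at h1
  rw [Nat.mul_sub]
  omega

theorem length_right (h : IsSolution x y u v p q w z i j k) :
    q.length = k * (x.length - u.length) := by
  have h1 := congrArg length h.right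
  have h2 := h.lt
  simp only [length_mul, length_pow] at h1
  rw [Nat.mul_sub]
  omega

theorem length_mid (h : IsSolution x y u v p q w z i j k) :
    j * v.length = p.length + j * y.length + q.length := by
  have h1 := congrArg length h.mid
  simpa only [length_mul, length_pow] using h1

theorem length_w (h : IsSolution x y u v p q w z i j k) : w.length = v.length :=
  (length_eq_of_semiconjBy h.semiconj_mid).symm

theorem length_z (h : IsSolution x y u v p q w z i j k) : z.length = x.length :=
  (length_eq_of_semiconjBy h.semiconj_outer).symm

theorem u_dvd_x (h : IsSolution x y u v p q w z i j k) : u ∣ x := by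
  have h0 : i ≠ 0 := by have := h.one_le_left; omega
  refine dvd_of_dvd_of_length_le (w := x ^ i) ?_ (dvd_pow_self x h0) h.lt.le
  rw [h.left]
  exact (dvd_pow_self u h0).mul_right p

theorem pairwiseCommute_of_commute_outer (h : IsSolution x y u v p q w z i j k)
    (hxu : Commute x u) : PairwiseCommute x y u v := by
  obtain ⟨t, rfl⟩ := h.u_dvd_x
  have htu : Commute u t := by
    have := hxu.eq
    rw [mul_assoc] at this
    exact (mul_left_cancel this).symm
  have ht : t ≠ 1 := by
    rintro rfl
    simpa using h.lt
  have hp : p = t ^ i := by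
    have := h.left
    rw [htu.mul_pow] at this
    exact (mul_left_cancel this).symm
  have hq : q = t ^ k := by
    have := h.right
    rw [htu.eq, htu.symm.mul_pow] at this
    exact (mul_right_cancel this).symm
  have hty : Commute t y := by
    have h1 := h.conj_mid
    rw [hp, hq, ← pow_add, add_comm] at h1
    have := h.three_le_add
    have := h.three_le
    exact commute_of_pow_mul_pow_eq_pow (by omega) (by omega) (by omega) h1.symm
  have htv : Commute t v := by
    refine commute_of_commute_pow (n := j) (by have := h.three_le; omega) ?_
    rw [h.mid, hp, hq]
    exact ((Commute.self_pow t i).mul_right (hty.pow_right j)).mul_right (Commute.self_pow t k)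
  have htx : Commute t (u * t) := htu.symm.mul_right (Commute.refl t)
  exact ⟨commute_of_commute_of_ne_one htx.symm ht hty, hxu,
    commute_of_commute_of_ne_one htx.symm ht htv,
    commute_of_commute_of_ne_one hty.symm ht htu.symm,
    commute_of_commute_of_ne_one hty.symm ht htv,
    commute_of_commute_of_ne_one htu ht htv⟩

theorem eq_pow_mul (h : IsSolution x y u v p q w z i j k) : u ^ (i + k) * p = u ^ k * x ^ i := by
  rw [h.left, add_comm, pow_add, mul_assoc]

theorem pairwiseCommute_of_commute_conj_outer (h : IsSolution x y u v p q w z i j k)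
    (huz : Commute u z) : PairwiseCommute x y u v := by
  have h1 := h.semiconj_outer.eq
  rw [h.eq_pow_mul, ← mul_assoc, ← (huz.pow_left k).eq, mul_assoc, mul_assoc] at h1
  have h2 := mul_left_cancel h1
  rw [← pow_succ, pow_succ'] at h2
  obtain rfl := mul_right_cancel h2
  exact h.pairwiseCommute_of_commute_outer huz.symm

theorem pairwiseCommute_of_commute_conj_mid (h : IsSolution x y u v p q w z i j k)
    (hyw : Commute y w) : PairwiseCommute x y u v := by
  have h0 := h.three_le
  have h1 := h.three_le_add
  have hl : y.length ≤ w.length := by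
    have := h.length_mid
    rw [h.length_w]
    nlinarith
  obtain ⟨s, rfl⟩ : IsSuffix y w := by
    have h2 : ∀ t : FreeMonoid A, IsSuffix t (t ^ j) := fun t => by
      obtain ⟨m, rfl⟩ : ∃ m, j = m + 1 := ⟨j - 1, by omega⟩
      exact ⟨t ^ m, pow_succ t m⟩
    exact (((h2 y).trans (isSuffix_mul _ _)).of_length_le (h.conj_mid ▸ h2 w) hl)
  have hsy : Commute s y := by
    have := hyw.eq
    rw [← mul_assoc] at this
    exact (mul_right_cancel this).symm
  have hs : q * p = s ^ j := by
    have := h.conj_mid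
    rw [hsy.mul_pow] at this
    exact (mul_right_cancel this).symm
  obtain ⟨s', hs', -⟩ := exists_conj_pow hs
  have h2 := h.conj_outer
  rw [mul_assoc, hs'] at h2
  have h3 : Commute u s' :=
    commute_of_pow_mul_pow_eq_pow (by omega) (by omega) (by omega) h2.symm
  refine h.pairwiseCommute_of_commute_conj_outer
    (commute_of_commute_pow (n := i + k) (by omega) ?_)
  rw [h2]
  exact (Commute.self_pow u _).mul_right (h3.pow_right j)

theorem pairwiseCommute_of_length_x_le (h : IsSolution x y u v p q w z i j k)
    (hl : u.length + x.length ≤ (i + k) * u.length) : PairwiseCommute x y u v := by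
  refine h.pairwiseCommute_of_commute_conj_outer (commute_of_dvd (w := u ^ (i + k))
    (dvd_mul_of_commute (Commute.self_pow u _))
    (dvd_mul_self_of_dvd_pow (n := i + k) ?_) ?_)
  · rw [h.conj_outer, mul_assoc]
    exact dvd_mul_right _ _
  · rwa [h.length_z, length_pow]

theorem pairwiseCommute_of_length_v_le (h : IsSolution x y u v p q w z i j k)
    (hl : y.length + v.length ≤ j * y.length) : PairwiseCommute x y u v := by
  refine h.pairwiseCommute_of_commute_conj_mid (commute_of_isSuffix (w := y ^ j)
    ⟨y, (Commute.self_pow y j).symm⟩ (IsSuffix.self_mul_of_pow ⟨_, h.conj_mid⟩) ?_)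
  rwa [h.length_w, length_pow]

end IsSolution

theorem commute_of_semiconjBy_pow_mul_pow {u x z : FreeMonoid A} {k m : ℕ}
    (h : SemiconjBy (u ^ k * x ^ m) x z) (hc : Commute u z) : Commute u x := by
  have h1 := h.eq
  rw [← mul_assoc, ← (hc.pow_left k).eq, mul_assoc, mul_assoc] at h1
  have h2 := mul_left_cancel h1
  rw [← pow_succ, pow_succ'] at h2
  obtain rfl := mul_right_cancel h2
  exact hc

theorem isSuffix_pow_self (t : FreeMonoid A) {n : ℕ} (hn : n ≠ 0) : IsSuffix t (t ^ n) := by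
  obtain ⟨m, rfl⟩ := Nat.exists_eq_succ_of_ne_zero hn
  exact ⟨t ^ m, pow_succ t m⟩

/-- A word commuting with a shorter nonempty word is a proper power. -/
theorem exists_eq_pow_of_commute {a b : FreeMonoid A} (h : Commute a b)
    (hl : b.length < a.length) (hb : b ≠ 1) : ∃ t r, 2 ≤ r ∧ a = t ^ r := by
  obtain ⟨t, r, s, rfl, rfl⟩ := exists_pow_of_commute h
  refine ⟨t, r, ?_, rfl⟩
  rw [length_pow, length_pow] at hl
  have h1 : s < r := lt_of_mul_lt_mul_right hl (Nat.zero_le _)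
  have h2 : s ≠ 0 := by
    rintro rfl
    exact hb (pow_zero t)
  omega

namespace IsSolution

variable {x y u v p q w z : FreeMonoid A} {i j k : ℕ}

theorem length_x_lt_length_left (h : IsSolution x y u v p q w z i j k) (hi : 2 ≤ i)
    (hx : (i + k) * u.length < u.length + x.length) : x.length < p.length := by
  have h1 := h.length_left
  have h2 := h.three_le_add
  have h3 : 2 * (x.length - u.length) ≤ p.length := by rw [h1]; gcongr
  have h4 : 3 * u.length ≤ (i + k) * u.length := by gcongr
  have := h.lt
  omega

theorem v_ne_one (h : IsSolution x y u v p q w z i j k) : v ≠ 1 := by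
  rintro rfl
  have h1 := h.length_mid
  have h2 := h.length_left
  have h3 : 1 * 1 ≤ i * (x.length - u.length) :=
    Nat.mul_le_mul h.one_le_left (by have := h.lt; omega)
  simp only [length_one] at h1
  omega

theorem w_ne_one (h : IsSolution x y u v p q w z i j k) : w ≠ 1 := by
  intro hw
  have h1 := h.length_w
  rw [hw, length_one] at h1
  exact h.v_ne_one (length_eq_zero.1 h1.symm)

theorem x_ne_one (h : IsSolution x y u v p q w z i j k) : x ≠ 1 := by
  rintro rfl
  simpa using h.lt

theorem z_ne_one (h : IsSolution x y u v p q w z i j k) : z ≠ 1 := by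
  intro hz
  have h1 := h.length_z
  rw [hz, length_one] at h1
  exact h.x_ne_one (length_eq_zero.1 h1.symm)

theorem pairwiseCommute_of_v_short (h : IsSolution x y u v p q w z i j k) (hi : 2 ≤ i)
    (hx : (i + k) * u.length < u.length + x.length) (hvx : v.length ≤ x.length)
    (hvq : v.length ≤ q.length) : PairwiseCommute x y u v := by
  have hxp := h.length_x_lt_length_left hi hx
  have hk := h.one_le_right
  have h3 := h.three_le_add
  have hwl := h.length_w
  obtain ⟨f, rfl⟩ : IsSuffix x p :=
    (isSuffix_pow_self x (by omega)).of_length_le ⟨_, h.left⟩ hxp.le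
  have hwq : w ∣ q := dvd_of_dvd_of_length_le (w := w * q) (dvd_mul_right _ _)
    (h.semiconj_mid.eq ▸ dvd_mul_right _ _) (by omega)
  have hwx : w ∣ x := dvd_of_dvd_of_length_le (w := x ^ k)
    (hwq.trans (h.right ▸ dvd_mul_right _ _)) (dvd_pow_self x (by omega)) (by omega)
  have h4 : q * f * w ∣ w ^ j := by
    rw [h.conj_mid, ← mul_assoc q]
    exact (mul_dvd_mul_left _ hwx).mul_right _
  have h5 : w * (q * f) ∣ w ^ (j + 1) := by
    rw [pow_succ']
    exact mul_dvd_mul_left _ ((dvd_mul_right _ _).trans h4)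
  have h6 : Commute (q * f) w := eq_of_dvd_of_length_eq (h4.trans (pow_dvd_pow w j.le_succ)) h5
    (by simp only [length_mul]; omega)
  obtain ⟨t, r, hr, ht⟩ := exists_eq_pow_of_commute h6
    (by simp only [length_mul] at *; omega) h.w_ne_one
  obtain ⟨t', ht', -⟩ := exists_conj_pow ht
  obtain ⟨m, rfl⟩ : ∃ m, i = m + 1 := ⟨i - 1, by omega⟩
  have h7 : x ^ m = u ^ (m + 1) * f := by
    have := h.left
    rw [pow_succ, ← mul_assoc] at this
    exact mul_right_cancel this
  have h8 : u ^ (m + 1 + k) * f = u ^ k * x ^ m := by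
    rw [h7, add_comm, pow_add, mul_assoc]
  have h9 : q * (u ^ (m + 1 + k) * f) = x ^ (k + m) := by
    rw [h8, pow_add x, h.right, mul_assoc]
  obtain ⟨x', h10, h11, -⟩ := exists_conj_pow h9
  rw [mul_assoc, ht'] at h10
  rw [h8] at h11
  have h12 := commute_of_pow_mul_pow_eq_pow (by omega) hr (by omega) h10
  refine h.pairwiseCommute_of_commute_outer (commute_of_semiconjBy_pow_mul_pow h11
    (commute_of_commute_pow (n := k + m) (by omega) ?_)).symm
  rw [← h10]
  exact (Commute.self_pow u _).mul_right (h12.pow_right r)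

theorem pairwiseCommute_of_v_medium (h : IsSolution x y u v p q w z i j k)
    (hxv : x.length < v.length) (hvp : v.length ≤ p.length) (hxq : x.length < q.length) :
    PairwiseCommute x y u v := by
  have hj := h.three_le
  have hzl := h.length_z
  have hi := h.one_le_left
  have hvd : v ∣ v ^ j := dvd_pow_self v (by omega)
  obtain ⟨f, rfl⟩ : v ∣ p := dvd_of_dvd_of_length_le hvd
    (by rw [h.mid, mul_assoc]; exact dvd_mul_right _ _) hvp
  obtain ⟨m, rfl⟩ : ∃ m, j = m + 1 := ⟨j - 1, by omega⟩
  have h1 : q * f * y ^ (m + 1) = w ^ m := by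
    have := h.conj_mid
    rw [← mul_assoc, h.semiconj_mid.eq, pow_succ', mul_assoc, mul_assoc] at this
    rw [mul_assoc]
    exact (mul_left_cancel this).symm
  have hsz := isSuffix_pow_self z (n := i + k) (by omega)
  have hzq : IsSuffix z q := hsz.of_length_le ⟨_, h.conj_outer⟩ (by omega)
  have hzv : IsSuffix z v := (hzq.trans ⟨_, h.mid⟩).of_length_le
    (isSuffix_pow_self v (by omega)) (by omega)
  have h2 : IsSuffix (z * (f * q)) (z ^ (i + k)) := by
    obtain ⟨c, hc⟩ := hzv
    refine ⟨u ^ (i + k) * c, ?_⟩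
    rw [h.conj_outer, hc]
    simp only [mul_assoc]
  have h3 : IsSuffix (f * q * z) (z ^ (i + k + 1)) := by
    obtain ⟨c, hc⟩ := h2
    exact ⟨c * z, by rw [pow_succ, hc]; simp only [mul_assoc]⟩
  have h4 : Commute (f * q) z := h3.eq_of_length_eq
    (h2.trans ⟨z, pow_succ' _ _⟩) (by simp only [length_mul]; omega)
  obtain ⟨t, r, hr, ht⟩ := exists_eq_pow_of_commute h4
    (by simp only [length_mul]; omega) h.z_ne_one
  obtain ⟨t', ht', -⟩ := exists_conj_pow ht
  rw [ht'] at h1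
  have h5 := commute_of_pow_mul_pow_eq_pow hr (by omega) (by omega) h1
  refine h.pairwiseCommute_of_commute_conj_mid (commute_of_commute_pow (n := m) (by omega) ?_)
  rw [← h1]
  exact (h5.symm.pow_right r).mul_right (Commute.self_pow y _)

end IsSolution

theorem commute_of_pow_mul_semiconj {u b c : FreeMonoid A} {n : ℕ} (hn : n ≠ 0)
    (hb : b.length = u.length) (h : SemiconjBy c (u ^ (n + 1)) (u ^ n * b)) : Commute c u := by
  obtain ⟨d, h1, h2⟩ := exists_of_semiconjBy_pow n.succ_ne_zero h
  have hl := length_eq_of_semiconjBy h1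
  rw [pow_succ] at h2
  have h3 := eq_of_pow_eq hn (eq_and_eq_of_mul_eq_mul' h2 (by omega)).1
  rwa [h3] at h1

theorem commute_of_mul_pow_semiconj {u b c : FreeMonoid A} {n : ℕ} (hn : n ≠ 0)
    (hb : b.length = u.length) (h : SemiconjBy c (u ^ (n + 1)) (b * u ^ n)) : Commute c u := by
  obtain ⟨d, h1, h2⟩ := exists_of_semiconjBy_pow n.succ_ne_zero h
  have hl := length_eq_of_semiconjBy h1
  rw [pow_succ'] at h2
  have h3 := eq_of_pow_eq hn (eq_and_eq_of_mul_eq_mul h2 (by omega)).2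
  rwa [h3] at h1

theorem commute_of_commute_mul_pow {u r q v : FreeMonoid A} {n : ℕ} (hn : n ≠ 0)
    (hq : q * u = u ^ n * r) (hqv : IsSuffix q v) (hv : Commute v (r * u ^ n)) : Commute r u := by
  have hl := congrArg length hq
  simp only [length_mul] at hl
  obtain ⟨b, hb⟩ : IsSuffix q (r * u ^ n) :=
    (hqv.trans (hv.eq ▸ isSuffix_mul _ _ : IsSuffix v (v * (r * u ^ n)))).of_length_le
      (isSuffix_mul _ _) (by rw [length_mul]; omega)
  refine commute_of_mul_pow_semiconj hn (b := b) ?_ ?_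
  · have := congrArg length hb
    simp only [length_mul] at this
    omega
  · change r * u ^ (n + 1) = b * u ^ n * r
    rw [pow_succ, ← mul_assoc, hb, mul_assoc, hq, mul_assoc]

theorem commute_of_overlap_commute {u a r f : FreeMonoid A} (hr : r ≠ 1) (hf : f ≠ 1)
    (hfu : f ∣ u) (ha : SemiconjBy u r a) (hfr : Commute f r) : Commute r u := by
  have h1 : IsSuffix u (r ^ u.length) :=
    (show IsSuffix u (u * r ^ u.length) from ⟨a ^ u.length, (ha.pow_right _).eq⟩).of_length_le
      (isSuffix_mul _ _) (by
        rw [length_pow]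
        exact Nat.le_mul_of_pos_right _ (length_pos_of_ne_one hr))
  have h2 : IsSuffix (u * f) (f * r ^ u.length) := by
    obtain ⟨c, hc⟩ := h1
    exact ⟨c, by rw [(hfr.pow_right _).eq, hc, mul_assoc]⟩
  obtain ⟨e, he⟩ := (h1.trans (isSuffix_mul f _)).of_length_le h2 (by simp)
  have h3 : e = f := eq_of_dvd_of_length_eq (w := u * f) (he ▸ dvd_mul_right _ _)
    (hfu.mul_right f) (by
      have := congrArg length he
      simp only [length_mul] at this
      omega)
  rw [h3] at he
  exact commute_of_commute_of_ne_one hfr.symm hf he.symm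

/-- The case where the overlap `f` of the two factorizations is at least as long as `r`. -/
theorem commute_of_length_le_overlap {x u v p q a r f g : FreeMonoid A} {m : ℕ} (hu : u ≠ 1)
    (hr : r ≠ 1) (hxq : x = q * u) (hxr : x = u ^ (m + 2) * r) (ha : SemiconjBy u r a)
    (hp : p = r * x ^ (m + 1)) (hpv : p = v * f) (hv : v = g * q) (hfp : f ∣ p)
    (hpp : p ∣ v * p) (hl : r.length ≤ f.length) : Commute r u := by
  have hqr : q * u = u ^ (m + 2) * r := hxq ▸ hxr
  have hqv : IsSuffix q v := ⟨g, hv⟩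
  rcases le_or_gt x.length f.length with hxf | hxf
  · refine commute_of_commute_mul_pow (by omega) hqr hqv (commute_of_dvd hpp ?_ ?_)
    · refine ⟨x, ?_⟩
      rw [hp, mul_assoc r, ← mul_assoc _ r, ← hxr, ← pow_succ', mul_assoc, ← pow_succ]
    · rw [hpv, length_mul]
      have := congrArg length hxr
      simp only [length_mul] at *
      omega
  have hsx : IsSuffix x p := ⟨r * x ^ m, by rw [hp, pow_succ, mul_assoc]⟩
  have hsf : IsSuffix f p := ⟨v, hpv⟩
  have hfx : IsSuffix f x := hsf.of_length_le hsx hxf.le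
  obtain ⟨c, hc⟩ : r ∣ f := dvd_of_dvd_of_length_le (hp ▸ dvd_mul_right _ _) hfp hl
  obtain ⟨d, hd⟩ : IsSuffix r f := (hxr ▸ isSuffix_mul _ _ : IsSuffix r x).of_length_le hfx hl
  have hdu : IsSuffix d (u ^ (m + 2)) := by
    obtain ⟨e, he⟩ := hfx
    refine ⟨e, ?_⟩
    rw [hxr, hd, ← mul_assoc] at he
    exact mul_right_cancel he
  have hcx : c ∣ x := by
    have h1 : c ∣ x ^ (m + 1) := by
      obtain ⟨e, he⟩ := hfp
      refine ⟨e, ?_⟩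
      rw [hp, hc, mul_assoc] at he
      exact mul_left_cancel he
    refine dvd_of_dvd_of_length_le h1 (dvd_pow_self x (by omega)) ?_
    have := congrArg length hc
    simp only [length_mul] at this
    omega
  have hcd : c.length = d.length := by
    have h1 := congrArg length hc
    have h2 := congrArg length hd
    simp only [length_mul] at h1 h2
    omega
  have hcu : c ∣ u ^ (m + 2) := dvd_of_dvd_of_length_le hcx (hxr ▸ dvd_mul_right _ _)
    (hcd.trans_le (by
      obtain ⟨e, he⟩ := hdu
      rw [he, length_mul]
      omega))
  have hcs : IsSuffix c x := (show IsSuffix c f from ⟨r, hc⟩).trans hfx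
  have hus : IsSuffix u x := ⟨q, hxq⟩
  rcases le_or_gt u.length c.length with huc | huc
  · obtain ⟨b, rfl⟩ := hus.of_length_le hcs huc
    have h1 : Commute b u := eq_of_dvd_of_length_eq (w := u ^ (m + 3))
      (hcu.trans (pow_dvd_pow u (by omega)))
      (by rw [pow_succ']; exact mul_dvd_mul_left u ((dvd_mul_right b u).trans hcu))
      (by simp only [length_mul]; omega)
    have h2 : Commute (b * u) u := h1.mul_left (Commute.refl u)
    have h3 : b * u = d := by
      refine IsSuffix.eq_of_length_eq (w := u ^ (m + 2)) ?_ hdu hcd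
      obtain ⟨e, he⟩ := hcu
      refine ⟨e, mul_left_cancel (a := b * u) ?_⟩
      rw [(h2.pow_right (m + 2)).eq, he, mul_assoc]
    have h4 : b * u ≠ 1 := by
      intro h
      have := congrArg length h
      have := length_pos_of_ne_one hu
      simp only [length_mul, length_one] at *
      omega
    refine commute_of_commute_of_ne_one (y := b * u) ?_ h4 h2
    rw [hd, ← h3] at hc
    exact hc.symm
  · have h1 : c = d := (hcs.of_length_le hus huc.le).eq_of_length_eq
      (hdu.of_length_le (isSuffix_pow_self u (by omega)) (by omega)) hcd
    have h2 : Commute c r := by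
      rw [hd, ← h1] at hc
      exact hc
    by_cases hc1 : c = 1
    · refine commute_of_commute_mul_pow (n := m + 2) (by omega) hqr hqv ?_
      have h3 : v = (r * u ^ (m + 2)) ^ (m + 1) := by
        have h4 : SemiconjBy r x (r * u ^ (m + 2)) := by
          rw [hxr]
          exact (mul_assoc _ _ _).symm
        have h5 := (h4.pow_right (m + 1)).eq
        rw [← hp, hpv, hc, hc1, mul_one] at h5
        exact mul_right_cancel h5
      rw [h3]
      exact Commute.pow_self _ _
    · exact commute_of_overlap_commute hr hc1
        (dvd_of_dvd_of_length_le hcu (dvd_pow_self u (by omega)) huc.le) ha h2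

/-- The case where the overlap `f` of the two factorizations is strictly between `u` and `r`. -/
theorem commute_of_overlap_between {x u q a r f g : FreeMonoid A} {m : ℕ}
    (hxq : x = q * u) (hxr : x = u ^ (m + 2) * r) (hqa : q = u ^ (m + 1) * a)
    (ha : SemiconjBy u r a) (hg : g * q * f = r * x ^ m * q * u)
    (hfr : f ∣ r) (huf : u.length < f.length) : Commute q u := by
  have hlr := length_le_of_dvd hfr
  obtain ⟨s, rfl⟩ : IsSuffix u r := (show IsSuffix u x from ⟨q, hxq⟩).of_length_le
    (hxr ▸ isSuffix_mul _ _) (by omega)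
  have has : a = u * s := by
    have := ha.eq
    rw [← mul_assoc] at this
    exact (mul_right_cancel this).symm
  have hqs : q = u ^ (m + 2) * s := by
    rw [hqa, has, pow_succ _ (m + 1), mul_assoc]
  obtain ⟨b, rfl⟩ : IsSuffix u f := (isSuffix_mul (s * u * x ^ m * q) u).of_length_le
    (hg ▸ isSuffix_mul _ _) huf.le
  have hbs : b ∣ s := by
    refine dvd_of_dvd_of_length_le ((dvd_mul_right b u).trans hfr) (dvd_mul_right s u) ?_
    simp only [length_mul] at hlr
    omega
  rw [← mul_assoc] at hg
  have hg' : g * (q * b) = s * u * x ^ m * q := by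
    rw [← mul_assoc]
    exact mul_right_cancel hg
  obtain ⟨c, hc, hc'⟩ := exists_eq_mul_of_mul_eq_mul' hg'.symm (by simp)
  have hcb : c.length = b.length := by
    have := congrArg length hc
    simp only [length_mul] at this
    omega
  have hcr : IsSuffix c (s * u) := by
    refine IsSuffix.of_length_le (⟨g, hc'⟩ : IsSuffix c (s * u * x ^ m)) ?_ (by
      simp only [length_mul] at hlr ⊢
      omega)
    rcases m with _ | m
    · exact ⟨1, by simp⟩
    · refine ⟨s * u * x ^ m * u ^ (m + 1 + 2), ?_⟩
      rw [pow_succ x, hxr]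
      simp only [mul_assoc]
  have hcu : c * u ^ (m + 2) = u ^ (m + 2) * b := by
    refine eq_of_dvd_of_length_eq (w := c * q) ?_ ?_ (by simp only [length_mul]; omega)
    · rw [hqs]
      exact mul_dvd_mul_left _ (dvd_mul_right _ _)
    · rw [← hc, hqs, mul_assoc]
      exact mul_dvd_mul_left _ (hbs.mul_right b)
  have hbs' : IsSuffix b s := by
    refine IsSuffix.of_length_le (w := c * q) (hc ▸ isSuffix_mul _ _) ?_ (length_le_of_dvd hbs)
    rw [hqs, ← mul_assoc]
    exact isSuffix_mul _ _
  obtain ⟨d, hd⟩ : IsSuffix c (b * u) := by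
    refine hcr.of_length_le ?_ (by rw [length_mul]; omega)
    obtain ⟨e, rfl⟩ := hbs'
    exact ⟨e, mul_assoc _ _ _⟩
  have hcu' : Commute c u := by
    refine commute_of_pow_mul_semiconj (n := m + 2) (b := d) (by omega) ?_ ?_
    · have := congrArg length hd
      simp only [length_mul] at this
      omega
    · change c * u ^ (m + 2 + 1) = u ^ (m + 2) * d * c
      rw [pow_succ, ← mul_assoc, hcu, mul_assoc, hd, mul_assoc]
  rw [(hcu'.pow_right _).eq] at hcu
  obtain rfl := mul_left_cancel hcu
  refine commute_of_commute_of_ne_one hc ?_ hcu'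
  rintro rfl
  simp at huf

/-- The case where the overlap `f` of the two factorizations is shorter than `u`. -/
theorem commute_of_overlap_short {x u q r a f g : FreeMonoid A} {m : ℕ}
    (hxq : x = q * u) (hxr : x = u ^ (m + 2) * r) (hqa : q = u ^ (m + 1) * a)
    (hg : g * q * f = r * x ^ m * q * u) (huf : f.length < u.length) : Commute q u := by
  obtain ⟨e', rfl⟩ : IsSuffix f u := (hg ▸ isSuffix_mul _ f).of_length_le
    (isSuffix_mul _ _) huf.le
  have hg' : g * q = r * x ^ m * (q * e') := by
    rw [← mul_assoc _ e', mul_assoc _ q e'] at hg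
    exact mul_right_cancel hg
  obtain ⟨e, he, -⟩ := exists_eq_mul_of_mul_eq_mul' hg' (by simp)
  have hel : e.length = e'.length := by
    have := congrArg length he
    simp only [length_mul] at this
    omega
  have huq : e' * f ∣ q := by
    rw [hqa]
    exact (dvd_pow_self _ (by omega)).mul_right _
  obtain rfl : e = e' := eq_of_dvd_of_length_eq (w := q * e') (he ▸ dvd_mul_right _ _)
    (((dvd_mul_right e' f).trans huq).mul_right _) hel
  have heu : Commute e (e * f) := by
    refine eq_of_dvd_of_length_eq (w := x) ?_ ?_ (by simp only [length_mul]; omega)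
    · rw [hxq]
      refine (mul_dvd_mul_left e huq).trans ?_
      rw [← he]
      exact mul_dvd_mul_left q (dvd_mul_right e f)
    · refine (mul_dvd_mul_left (e * f) (dvd_mul_right e f)).trans ?_
      rw [hxr, ← pow_two]
      exact (pow_dvd_pow _ (by omega)).mul_right r
  refine commute_of_commute_of_ne_one he ?_ heu
  rintro rfl
  simp at huf

/-- The case where the overlap of the two factorizations equals `u`. -/
theorem commute_of_overlap_eq {x y u q r v : FreeMonoid A} {m j : ℕ} (hj : 3 ≤ j)
    (hxq : x = q * u) (hxr : x = u ^ (m + 2) * (u * r)) (hv : v = u * r * x ^ m * q)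
    (hy : y ^ j * q * u = (r * x ^ m * x) ^ (j - 1))
    (hl : j * y.length < y.length + v.length) : Commute u r := by
  have hlv := congrArg length hv
  have hly := congrArg length hy
  have hlq := congrArg length hxq
  have hlr := congrArg length hxr
  obtain ⟨n, rfl⟩ : ∃ n, j = n + 3 := ⟨j - 3, by omega⟩
  rw [show n + 3 - 1 = n + 2 by omega] at hy hly
  simp only [length_mul, length_pow] at hlv hly hlq hlr
  have hyl : (n + 2) * y.length < v.length := by nlinarith
  have h1 : (n + 3) * y.length + x.length = (n + 2) * v.length := by
    have : v.length = r.length + m * x.length + x.length := by omega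
    rw [this, ← hly]
    omega
  have h2 : (n + 1) * (n + 2) * v.length + 0 < (n + 2) * x.length + v.length := by
    nlinarith
  have hvx : v.length = r.length + m * x.length + x.length := by omega
  obtain rfl : n = 0 := by
    by_contra hn
    have h3 : 2 * (n + 2) * v.length ≤ (n + 1) * (n + 2) * v.length := by
      gcongr
      omega
    have h4 : (n + 2) * x.length ≤ (n + 2) * v.length := by
      gcongr
      omega
    nlinarith
  obtain rfl : m = 0 := by
    by_contra hm
    have h3 : 1 * x.length ≤ m * x.length := by
      gcongr
      omega
    omega
  have hyq : y ^ 3 * x = r * x * r * x := by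
    rw [hxq, ← mul_assoc, hy, pow_zero, mul_one, pow_two, hxq]
    simp only [mul_assoc]
  have hy3 : y * (y * y) = (r * u) * ((u * u) * (r * r)) := by
    have h3 := mul_right_cancel hyq
    rw [hxr] at h3
    simpa only [pow_succ, pow_zero, one_mul, mul_assoc] using h3
  have hyy := (eq_and_eq_of_mul_eq_mul hy3 (by rw [length_mul]; omega)).2
  refine commute_of_pow_mul_pow_eq_pow (z := y) le_rfl le_rfl le_rfl ?_
  rw [pow_two, pow_two, pow_two, hyy]

namespace IsSolution

variable {x y u v p q w z : FreeMonoid A} {i j : ℕ}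

theorem length_v_le_length_left (h : IsSolution x y u v p q w z i j 1) (hi : 2 ≤ i)
    (hy : j * y.length < y.length + v.length) : v.length ≤ p.length := by
  by_contra! hlt
  have h1 := h.length_left
  have h2 := h.length_right
  have h3 := h.length_mid
  have h4 : 2 * q.length ≤ p.length := by rw [h1, h2]; nlinarith
  obtain ⟨n, rfl⟩ : ∃ n, j = n + 3 := ⟨j - 3, by have := h.three_le; omega⟩
  nlinarith

theorem pairwiseCommute_of_right_one (h : IsSolution x y u v p q w z i j 1) (hi : 2 ≤ i)
    (hx : (i + 1) * u.length < u.length + x.length) (hy : j * y.length < y.length + v.length)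
    (hqv : q.length < v.length) : PairwiseCommute x y u v := by
  by_cases hu : u = 1
  · exact h.pairwiseCommute_of_commute_outer (hu ▸ Commute.one_right x)
  have hvp := h.length_v_le_length_left hi hy
  have hj := h.three_le
  obtain ⟨m, rfl⟩ : ∃ m, i = m + 2 := ⟨i - 2, by omega⟩
  have hxq : x = q * u := by simpa using h.right
  obtain ⟨r, hxr⟩ : u ^ (m + 2) ∣ x := dvd_of_dvd_of_length_le (w := x ^ (m + 2))
    (h.left ▸ dvd_mul_right _ _) (dvd_pow_self x (by omega)) (by rw [length_pow]; nlinarith)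
  have hr : r ≠ 1 := by
    rintro rfl
    have := congrArg length hxr
    simp only [mul_one, length_pow] at this
    nlinarith
  have hru : Commute r u → PairwiseCommute x y u v := fun h1 =>
    h.pairwiseCommute_of_commute_outer
      (hxr ▸ (Commute.pow_self u (m + 2)).mul_left h1)
  have hqu : Commute q u → PairwiseCommute x y u v := fun h1 =>
    h.pairwiseCommute_of_commute_outer (hxq ▸ h1.mul_left (Commute.refl u))
  have hqr : q * u = u ^ (m + 2) * r := hxq ▸ hxr
  obtain ⟨a, hqa, ha⟩ := exists_eq_mul_of_mul_eq_mul
    (show u ^ (m + 1) * (u * r) = q * u by rw [hqr, pow_succ _ (m + 1), mul_assoc]) (by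
      have := congrArg length hqr
      simp only [length_mul, length_pow] at *
      nlinarith)
  have hp : p = r * x ^ (m + 1) := by
    have := h.left
    nth_rewrite 1 [pow_succ', hxr] at this
    rw [mul_assoc] at this
    exact (mul_left_cancel this).symm
  have hpd : p ∣ v ^ j := by
    rw [h.mid, mul_assoc]
    exact dvd_mul_right _ _
  obtain ⟨f, hpv⟩ : v ∣ p := dvd_of_dvd_of_length_le (dvd_pow_self v (by omega)) hpd hvp
  obtain ⟨g, hv⟩ : IsSuffix q v := IsSuffix.of_length_le (w := v ^ j) (h.mid ▸ isSuffix_mul _ _)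
    (isSuffix_pow_self v (by omega)) hqv.le
  have hfy : f * y ^ j * q = v ^ (j - 1) := by
    have h1 := h.mid
    obtain ⟨n, rfl⟩ : ∃ n, j = n + 1 := ⟨j - 1, by omega⟩
    rw [hpv, pow_succ' v, mul_assoc, mul_assoc] at h1
    rw [mul_assoc]
    exact (mul_left_cancel h1).symm
  have hfp : f ∣ p := dvd_of_dvd_of_length_le (w := v ^ j)
    ((show f ∣ v ^ (j - 1) by rw [← hfy, mul_assoc]; exact dvd_mul_right _ _).trans
      (pow_dvd_pow v (by omega))) hpd (by rw [hpv, length_mul]; omega)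
  rcases le_or_gt r.length f.length with hl | hl
  · exact hru (commute_of_length_le_overlap hu hr hxq hxr ha hp hpv hv hfp
      (dvd_mul_self_of_dvd_pow hpd) hl)
  have hg : g * q * f = r * x ^ m * q * u := by
    rw [← hv, ← hpv, hp, mul_assoc _ q, ← hxq, pow_succ, mul_assoc]
  have hfr : f ∣ r := dvd_of_dvd_of_length_le hfp (hp ▸ dvd_mul_right _ _) hl.le
  rcases lt_trichotomy u.length f.length with huf | huf | huf
  · exact hqu (commute_of_overlap_between hxq hxr hqa ha hg hfr huf)
  · obtain rfl : u = f := (isSuffix_mul (r * x ^ m * q) u).eq_of_length_eq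
      (hg ▸ isSuffix_mul _ _) huf
    obtain ⟨s, rfl⟩ := hfr
    have hvs : v = u * s * x ^ m * q := hv.trans (mul_right_cancel hg)
    have hus : Commute u s := by
      refine commute_of_overlap_eq hj hxq hxr hvs ?_ hy
      have h1 : SemiconjBy u (s * x ^ m * x) v := by
        change u * _ = v * u
        rw [hvs, hxq]
        simp only [mul_assoc]
      have h2 := (h1.pow_right (j - 1)).eq
      rw [← hfy] at h2
      simp only [mul_assoc] at h2 ⊢
      exact (mul_left_cancel h2).symm
    exact hru ((Commute.refl u).mul_left hus.symm)
  · exact hqu (commute_of_overlap_short hxq hxr hqa hg huf)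

end IsSolution

theorem dvd_pow_of_dvd_mul_self {w z : FreeMonoid A} (h : w ∣ z * w) (n : ℕ) : w ∣ z ^ n * w := by
  induction n with
  | zero => simp
  | succ n ih =>
    rw [pow_succ', mul_assoc]
    exact h.trans (mul_dvd_mul_left z ih)

theorem dvd_pow_length {w z : FreeMonoid A} (h : w ∣ z * w) (hz : z ≠ 1) : w ∣ z ^ w.length := by
  refine dvd_of_dvd_of_length_le (dvd_pow_of_dvd_mul_self h w.length) (dvd_mul_right _ _) ?_
  rw [length_pow]
  exact Nat.le_mul_of_pos_right _ (length_pos_of_ne_one hz)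

theorem eq_of_shifted {x y r b c e f : FreeMonoid A} (hb : y = r * b) (hc : y = c * r)
    (he : x = e * (b * y * c)) (hf : x = b * y * c * f) (he1 : e ≠ 1)
    (hl : e.length ≤ r.length) : b = c := by
  have hlb := congrArg length hb
  have hlc := congrArg length hc
  simp only [length_mul] at hlb hlc
  have h1 : b ∣ e * b := dvd_of_dvd_of_length_le (w := x)
    (by rw [hf, mul_assoc, mul_assoc]; exact dvd_mul_right _ _)
    (by rw [he, mul_assoc, ← mul_assoc]; exact dvd_mul_right _ _) (by simp)
  obtain ⟨d, hd⟩ := h1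
  have hdl := congrArg length hd
  simp only [length_mul] at hdl
  have h2 : d * (y * c) = y * c * f := by
    refine mul_left_cancel (a := b) ?_
    rw [← mul_assoc, ← hd]
    simpa only [mul_assoc] using he.symm.trans hf
  have hd1 : d ≠ 1 := by
    rintro rfl
    refine he1 (length_eq_zero.1 ?_)
    simp only [length_one] at hdl
    omega
  have h3 : y * c ∣ d * (y * c) := ⟨f, h2⟩
  have h4 : y ∣ d * y := dvd_of_dvd_of_length_le ((dvd_mul_right y c).trans h3)
    (mul_dvd_mul_left d (dvd_mul_right y c)) (by simp)
  have h5 : y ∣ c * y := ⟨b, by rw [hc, mul_assoc, ← hb, hc]⟩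
  have h6 : Commute d c := commute_of_dvd h4 h5 (by omega)
  have h7 := dvd_pow_length h3 hd1
  have h8 : y * c = c * y := by
    refine eq_of_dvd_of_length_eq (w := d ^ (y * c).length * c) (h7.mul_right c) ?_
      (by simp only [length_mul]; omega)
    rw [(h6.pow_left _).eq]
    exact mul_dvd_mul_left c ((dvd_mul_right y c).trans h7)
  have h9 : c * y = y * b := by
    nth_rewrite 1 [hb]
    rw [← mul_assoc, ← hc]
  exact (mul_left_cancel (h8.trans h9)).symm

namespace IsSolution

variable {x y u v p q w z : FreeMonoid A} {i j k : ℕ}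

theorem length_x_lt_length_right (h : IsSolution x y u v p q w z i j k) (hk : 2 ≤ k)
    (hx : (i + k) * u.length < u.length + x.length) : x.length < q.length := by
  have h1 := h.length_right
  have h2 := h.three_le_add
  have h3 : 2 * (x.length - u.length) ≤ q.length := by rw [h1]; gcongr
  have h4 : 3 * u.length ≤ (i + k) * u.length := by gcongr
  have := h.lt
  omega

theorem length_x_le (h : IsSolution x y u v p q w z i j k) (hik : 4 ≤ i + k)
    (hx : (i + k) * u.length < u.length + x.length) :
    8 * x.length ≤ 3 * (p.length + q.length) := by
  rw [h.length_left, h.length_right, ← Nat.add_mul]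
  obtain ⟨n, hn⟩ : ∃ n, i + k = n + 4 := ⟨i + k - 4, by omega⟩
  obtain ⟨m, hm⟩ : ∃ m, x.length = u.length + m := ⟨x.length - u.length, by have := h.lt; omega⟩
  rw [hn, hm] at hx
  rw [hn, hm, Nat.add_sub_cancel_left]
  have h1 : 4 * u.length ≤ (n + 4) * u.length := by gcongr; omega
  have h2 : 4 * m ≤ (n + 4) * m := by gcongr; omega
  omega

/-- If `v = t * d * s` with `p = t * d` and `q = d * s`, and `x` is shorter than `d`. -/
theorem pairwiseCommute_of_x_short {s t d : FreeMonoid A} (h : IsSolution x y u v p q w z i 3 k)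
    (hp : p = t * d) (hq : q = d * s) (hw : w = d * (s * t))
    (hy : y ^ 3 = s * t * (d * (s * t))) (hxd : x.length < d.length) :
    PairwiseCommute x y u v := by
  have h1 : (u ^ (i + k) * t) * (d * (d * s)) = z ^ (i + k) := by
    rw [h.conj_outer, hp, hq]
    simp only [mul_assoc]
  obtain ⟨x', h2, -, -, h3⟩ := exists_conj_pow h1
  rw [h.length_z] at h3
  have h4 : d * d ∣ x' ^ (i + k) := by
    rw [← h2]
    exact ⟨s * (u ^ (i + k) * t), by simp only [mul_assoc]⟩
  have h5 : d ∣ x' ^ (i + k) := (dvd_mul_right d d).trans h4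
  have h6 : x' ∣ d := dvd_of_dvd_of_length_le
    (dvd_pow_self x' (by have := h.three_le_add; omega)) h5 (by omega)
  have h7 : Commute d x' := eq_of_dvd_of_length_eq (w := x' ^ (i + k + 1))
    (((mul_dvd_mul_left d h6).trans h4).trans (pow_dvd_pow _ (by omega)))
    (by rw [pow_succ']; exact mul_dvd_mul_left x' h5) (by simp only [length_mul]; omega)
  obtain ⟨c, n, hn, rfl⟩ := exists_eq_pow_of_commute h7 (by omega) (by
    rintro rfl
    rw [length_one] at h3
    exact h.x_ne_one (length_eq_zero.1 h3.symm))
  obtain ⟨y', h8, h9, -⟩ := exists_conj_pow hy.symm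
  rw [mul_assoc, ← pow_two] at h8
  have h10 := commute_of_pow_mul_pow_eq_pow hn le_rfl (by omega) h8
  have h11 : Commute (c ^ n * (s * t)) y' := by
    refine commute_of_commute_pow (n := 3) (by omega) ?_
    rw [← h8]
    exact (((Commute.refl (c ^ n)).mul_right ((h10.pow_pow n 2))).mul_left
      ((h10.symm.pow_right n).mul_right (Commute.self_pow (s * t) 2)))
  have h12 := h9.eq
  rw [← h11.eq] at h12
  obtain rfl := mul_left_cancel h12
  refine h.pairwiseCommute_of_commute_conj_mid ?_
  rw [hw]
  exact h11.symm

theorem pairwiseCommute_of_v_long (h : IsSolution x y u v p q w z i j k) (hk : 2 ≤ k)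
    (hik : k ≤ i) (hx : (i + k) * u.length < u.length + x.length)
    (hy : j * y.length < y.length + v.length) (hpv : p.length < v.length) :
    PairwiseCommute x y u v := by
  have hqp : q.length ≤ p.length := by rw [h.length_left, h.length_right]; gcongr
  have hM := h.length_mid
  have hdiv : v ∣ v ^ j := dvd_pow_self v (by have := h.three_le; omega)
  obtain rfl : j = 3 := by
    by_contra hj
    obtain ⟨n, rfl⟩ : ∃ n, j = n + 4 := ⟨j - 4, by have := h.three_le; omega⟩
    nlinarith
  obtain ⟨s, hs⟩ : p ∣ v := dvd_of_dvd_of_length_le (w := v ^ 3)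
    (by rw [h.mid, mul_assoc]; exact dvd_mul_right _ _) hdiv hpv.le
  obtain ⟨t, ht⟩ : IsSuffix q v := IsSuffix.of_length_le (w := v ^ 3)
    (h.mid ▸ isSuffix_mul _ _) (isSuffix_pow_self v (by omega)) (by omega)
  have hls := congrArg length hs
  have hlt := congrArg length ht
  simp only [length_mul] at hls hlt
  obtain ⟨d, hp, hq⟩ := exists_eq_mul_of_mul_eq_mul (ht.symm.trans hs) (by omega)
  have hyv : y ^ 3 = s * t * (d * (s * t)) := by
    have h1 : p * (y ^ 3 * q) = p * (s * (v * (t * q))) := by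
      rw [← mul_assoc, ← h.mid, ← mul_assoc p s, ← hs, ← ht, pow_succ, pow_two, mul_assoc]
    have h2 := mul_left_cancel h1
    rw [hs, hp] at h2
    simp only [← mul_assoc] at h2 ⊢
    exact mul_right_cancel h2
  have hw : w = d * (s * t) := by
    have h1 := h.semiconj_mid.eq
    nth_rewrite 1 [hq] at h1
    rw [ht, ← mul_assoc] at h1
    rw [← mul_right_cancel h1, mul_assoc]
  rcases lt_or_ge x.length d.length with hxd | hxd
  · exact h.pairwiseCommute_of_x_short hp hq hw hyv hxd
  have hlp := congrArg length hp
  have hlq := congrArg length hq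
  have hly := congrArg length hyv
  simp only [length_mul, length_pow] at hlp hlq hly
  obtain ⟨r, hr⟩ : ∃ r, r = s * t := ⟨_, rfl⟩
  have hlr := congrArg length hr
  simp only [length_mul] at hlr
  rw [← hr] at hyv hw
  have hyy : r * (d * r) = y * (y * y) := by rw [← hyv, pow_succ', pow_two]
  obtain ⟨b, hb, hb'⟩ := exists_eq_mul_of_mul_eq_mul hyy (by omega)
  obtain ⟨c, hc, hc'⟩ := exists_eq_mul_of_mul_eq_mul' (c := b * y)
    (by rw [hb', mul_assoc] : d * r = b * y * y) (by omega)
  have hlb := congrArg length hb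
  have hlc := congrArg length hc
  have hld := congrArg length hc'
  simp only [length_mul] at hlb hlc hld
  have hxpq := h.length_x_le (by omega) hx
  have key : 6 * b.length + 8 * (x.length - d.length) ≤ r.length := by omega
  have hbc : b = c := by
    obtain ⟨e, he⟩ : IsSuffix d x :=
      IsSuffix.of_length_le (w := x ^ i) ((show IsSuffix d p from ⟨t, hp⟩).trans ⟨_, h.left⟩)
        (isSuffix_pow_self x (by omega)) hxd
    obtain ⟨f, hf⟩ : d ∣ x := dvd_of_dvd_of_length_le (w := x ^ k)
      ((show d ∣ q from ⟨s, hq⟩).trans ⟨_, h.right⟩) (dvd_pow_self x (by omega)) hxd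
    rw [hc'] at he hf
    by_cases he1 : e = 1
    · rw [he1, one_mul] at he
      obtain ⟨n, rfl⟩ : ∃ n, i = n + 1 := ⟨i - 1, by omega⟩
      have h1 : x ^ n = u ^ (n + 1) * t := by
        have := h.left
        rw [hp, hc', ← he, pow_succ x, ← mul_assoc] at this
        exact mul_right_cancel this
      have h2 : IsSuffix t x := IsSuffix.of_length_le (w := x ^ n) ⟨_, h1⟩
        (isSuffix_pow_self x (by omega)) (by omega)
      have h3 : IsSuffix c t := IsSuffix.of_length_le (w := x) ⟨_, he⟩ h2 (by omega)
      have h4 : IsSuffix t (y ^ 3) := ⟨r * (d * s), by rw [hyv, hr]; simp only [mul_assoc]⟩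
      have h5 : IsSuffix b y := ⟨r, hb⟩
      exact (h5.trans (isSuffix_pow_self y (by omega))).eq_of_length_eq (h3.trans h4) (by omega)
    · refine eq_of_shifted hb hc he hf he1 ?_
      have := congrArg length he
      simp only [length_mul] at this
      omega
  subst hbc
  have hrb : Commute r b := hb.symm.trans hc
  have hyr : Commute y r := hb ▸ (Commute.refl r).mul_left hrb.symm
  have hyb : Commute y b := hb ▸ hrb.mul_left (Commute.refl b)
  refine h.pairwiseCommute_of_commute_conj_mid ?_
  rw [hw, hc']
  exact ((hyb.mul_right (Commute.refl y)).mul_right hyb).mul_right hyr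

end IsSolution

theorem IsSolution.pairwiseCommute {x y u v p q w z : FreeMonoid A} {i j k : ℕ}
    (h : IsSolution x y u v p q w z i j k) (hki : k ≤ i) : PairwiseCommute x y u v := by
  have hik := h.three_le_add
  rcases le_or_gt (u.length + x.length) ((i + k) * u.length) with hx | hx
  · exact h.pairwiseCommute_of_length_x_le hx
  rcases le_or_gt (y.length + v.length) (j * y.length) with hy | hy
  · exact h.pairwiseCommute_of_length_v_le hy
  by_cases hv : v.length ≤ x.length ∧ v.length ≤ q.length
  · exact h.pairwiseCommute_of_v_short (by omega) hx hv.1 hv.2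
  rcases h.one_le_right.eq_or_lt with rfl | hk
  · refine h.pairwiseCommute_of_right_one (by omega) hx hy ?_
    have := h.length_right
    omega
  · have hxq := h.length_x_lt_length_right hk hx
    rcases le_or_gt v.length p.length with hvp | hvp
    · exact h.pairwiseCommute_of_v_medium (by omega) hvp hxq
    · exact h.pairwiseCommute_of_v_long hk hki hx hy hvp

theorem pairwiseCommute_of_length_lt {x y u v : FreeMonoid A} {i j k : ℕ} (hi : 1 ≤ i)
    (hk : 1 ≤ k) (hik : 3 ≤ i + k) (hj : 3 ≤ j) (hlt : u.length < x.length)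
    (h : x ^ i * y ^ j * x ^ k = u ^ i * v ^ j * u ^ k) : PairwiseCommute x y u v := by
  rcases le_total k i with hki | hki
  · obtain ⟨p, q, w, z, hs⟩ := exists_isSolution hi hk hik hj hlt h
    exact hs.pairwiseCommute hki
  · have h' := congrArg reverse h
    simp only [reverse_mul, reverse_pow, ← mul_assoc] at h'
    obtain ⟨p, q, w, z, hs⟩ := exists_isSolution hk hi (by omega) hj (by simpa using hlt) h'
    simpa only [PairwiseCommute, commute_reverse] using hs.pairwiseCommute hki

end FreeMonoid

/-- If `x^i y^j x^k = u^i v^j u^k` with `x ≠ u`, `i, k ≥ 1`, `i + k ≥ 3` and `j ≥ 3`,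
then the words `x, y, u, v` pairwise commute. -/
theorem stmt0 {A : Type*} (x y u v : FreeMonoid A) (i j k : ℕ)
    (hxu : x ≠ u) (hi : 1 ≤ i) (hk : 1 ≤ k) (hik : 3 ≤ i + k) (hj : 3 ≤ j)
    (heq : x ^ i * y ^ j * x ^ k = u ^ i * v ^ j * u ^ k) :
    x * y = y * x ∧ x * u = u * x ∧ x * v = v * x ∧
      y * u = u * y ∧ y * v = v * y ∧ u * v = v * u := by
  rcases lt_trichotomy u.length x.length with hl | hl | hl
  · exact FreeMonoid.pairwiseCommute_of_length_lt hi hk hik hj hl heq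
  · refine absurd (FreeMonoid.eq_of_pow_eq (n := i) (by omega) ?_) hxu
    rw [mul_assoc, mul_assoc] at heq
    exact (FreeMonoid.eq_and_eq_of_mul_eq_mul heq (by simp only [FreeMonoid.length_pow, hl])).1
  · obtain ⟨huv, hux, huy, hvx, hvy, hxy⟩ :=
      FreeMonoid.pairwiseCommute_of_length_lt hi hk hik hj hl heq.symm
    exact ⟨hxy, hux.symm, hvx.symm, huy.symm, hvy.symm, huv⟩
end

section
/- Let x and y be words over an alphabet A, and let α = w·x and β = w'·y where w, w' are arbitrary products of copies of x and y (i.e., α ∈ {x,y}*x and β ∈ {x,y}*y). If α and β have a common suffix of length at least |x| + |y|, then x and y commute. -/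
/-- Of two suffixes of the same word, the shorter is a suffix of the longer. -/
theorem FreeMonoid.exists_eq_mul_of_mul_eq_mul_s2 {A : Type*} {a b c d : FreeMonoid A}
    (h : a * b = c * d) (hl : d.length ≤ b.length) : ∃ t, b = t * d := by
  obtain ⟨t, ht⟩ := List.suffix_of_suffix_length_le (l₃ := (c * d).toList)
    ⟨c.toList, rfl⟩ ⟨a.toList, congrArg FreeMonoid.toList h⟩ hl
  exact ⟨FreeMonoid.ofList t, ht.symm⟩

/-- A nontrivial product of copies of `x` and `y` ends with `x` or with `y`. -/
theorem Submonoid.eq_one_or_exists_mul_of_mem_closure_pair {M : Type*} [Monoid M] {x y w : M}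
    (hw : w ∈ Submonoid.closure ({x, y} : Set M)) :
    w = 1 ∨ ∃ v ∈ Submonoid.closure ({x, y} : Set M), w = v * x ∨ w = v * y := by
  induction hw using Submonoid.closure_induction_right with
  | one => exact Or.inl rfl
  | mul_right v hv z hz _ =>
    refine Or.inr ⟨v, hv, ?_⟩
    rcases hz with rfl | rfl
    · exact Or.inl rfl
    · exact Or.inr rfl

/-- If words in `{x,y}*x` and `{x,y}*y` share a suffix of length at least `|x| + |y|`, then `x`
and `y` commute. The proof is by induction on `|x| + |y|`: if `y = z * x`, the pair `x, y` is
replaced by `x, z`. -/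
theorem FreeMonoid.commute_of_long_common_suffix {A : Type*} (n : ℕ) :
    ∀ {x y w w' s t p : FreeMonoid A}, x.length + y.length ≤ n →
      w ∈ Submonoid.closure ({x, y} : Set (FreeMonoid A)) →
      w' ∈ Submonoid.closure ({x, y} : Set (FreeMonoid A)) →
      w * x = s * p → w' * y = t * p → x.length + y.length ≤ p.length → Commute x y := by
  induction n with
  | zero =>
    intro x y w w' s t p hn _ _ _ _ _
    have hx : x = 1 := FreeMonoid.length_eq_zero.mp (by omega)
    exact hx ▸ Commute.one_left y
  | succ n ih =>
    intro x y w w' s t p hn hw hw' hx hy hp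
    wlog hxy : x.length ≤ y.length generalizing x y w w' s t
    · rw [Set.pair_comm] at hw hw'
      exact (this (by omega) hw' hw hy hx (by omega) (by omega)).symm
    rcases Nat.eq_zero_or_pos x.length with hx0 | hx0
    · exact FreeMonoid.length_eq_zero.mp hx0 ▸ Commute.one_left y
    obtain ⟨q, rfl⟩ := FreeMonoid.exists_eq_mul_of_mul_eq_mul_s2 hx.symm (by omega)
    rw [← mul_assoc] at hx hy
    obtain ⟨z, rfl⟩ := FreeMonoid.exists_eq_mul_of_mul_eq_mul_s2 hy hxy
    rw [← mul_assoc] at hy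
    have hwq := mul_right_cancel hx
    have hzq := mul_right_cancel hy
    simp only [FreeMonoid.length_mul] at hn hp
    have hle : Submonoid.closure ({x, z * x} : Set (FreeMonoid A)) ≤
        Submonoid.closure {x, z} := by
      rw [Submonoid.closure_le]
      rintro _ (rfl | rfl)
      · exact Submonoid.subset_closure (by simp)
      · exact mul_mem (Submonoid.subset_closure (by simp)) (Submonoid.subset_closure (by simp))
    have hz : z ∈ Submonoid.closure ({x, z} : Set (FreeMonoid A)) :=
      Submonoid.subset_closure (by simp)
    have key : Commute x z := by
      rcases Submonoid.eq_one_or_exists_mul_of_mem_closure_pair hw with rfl | ⟨v, hv, rfl | rfl⟩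
      · have hl := congrArg FreeMonoid.length hwq
        simp only [FreeMonoid.length_mul, FreeMonoid.length_one] at hl
        omega
      · exact ih (by omega) (hle hv) (hle hw') hwq hzq (by omega)
      · rw [← mul_assoc] at hwq
        exact ih (by omega) (mul_mem (hle hv) hz) (hle hw') hwq hzq (by omega)
    exact key.mul_right (Commute.refl x)



/-- If `α ∈ {x,y}*x` and `β ∈ {x,y}*y` have a common suffix of length at least
`|x| + |y|`, then `x` and `y` commute. -/
theorem stmt2 {A : Type*} (x y α β p : FreeMonoid A)
    (hα : ∃ w ∈ Submonoid.closure ({x, y} : Set (FreeMonoid A)), α = w * x)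
    (hβ : ∃ w ∈ Submonoid.closure ({x, y} : Set (FreeMonoid A)), β = w * y)
    (hlen : x.length + y.length ≤ p.length)
    (hpα : ∃ s, α = s * p) (hpβ : ∃ s, β = s * p) :
    x * y = y * x := by
  obtain ⟨w, hw, rfl⟩ := hα
  obtain ⟨w', hw', rfl⟩ := hβ
  obtain ⟨s, hs⟩ := hpα
  obtain ⟨t, ht⟩ := hpβ
  exact FreeMonoid.commute_of_long_common_suffix _ le_rfl hw hw' hs ht hlen
end
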